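/- arXiv:1812.10597 — 2 statements merged into one kernel-verified Lean document; each statement's English description precedes it below -/
import Mathlib

section
/- Let R be a commutative Noetherian local ring, let M and N be finitely generated R-modules, fix a resolution ⋯ → F_2 → F_1 → F_0 → M → 0 of M by finite free R-modules, and let n ≥ 1 be an integer. If Ext^n_R(M,R) = 0, then Tor_n^R(M,N) ≅ Ext^1_R(Tr Ω^n M, N). -/
open CategoryTheory

/-- The `i`-th Ext module `Ext^i_R(X, Y)` of two `R`-modules. -/
noncomputable abbrev extMod (R : Type) [CommRing R] (i : ℕ)
    (X : Type) [AddCommGroup X] [Module R X]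
    (Y : Type) [AddCommGroup Y] [Module R Y] : Type :=
  ((Ext R (ModuleCat R) i).obj (Opposite.op (ModuleCat.of R X))).obj (ModuleCat.of R Y)

/-- The `i`-th Tor module `Tor_i^R(X, Y)` of two `R`-modules. -/
noncomputable abbrev torMod (R : Type) [CommRing R] (i : ℕ)
    (X : Type) [AddCommGroup X] [Module R X]
    (Y : Type) [AddCommGroup Y] [Module R Y] : Type :=
  ((Tor (ModuleCat R) i).obj (ModuleCat.of R X)).obj (ModuleCat.of R Y)

/-- A resolution `⋯ → F_2 → F_1 → F_0 → M → 0` of `M` by finite free `R`-modules. -/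
structure FiniteFreeResolution (R : Type) [CommRing R]
    (M : Type) [AddCommGroup M] [Module R M] where
  F : ℕ → Type
  [addCommGroup : ∀ n, AddCommGroup (F n)]
  [module : ∀ n, Module R (F n)]
  free : ∀ n, Module.Free R (F n)
  finite : ∀ n, Module.Finite R (F n)
  d : ∀ n, F (n + 1) →ₗ[R] F n
  ε : F 0 →ₗ[R] M
  surj : Function.Surjective ε
  exact_at_zero : Function.Exact (d 0) ε
  exact_at : ∀ n, Function.Exact (d (n + 1)) (d n)

attribute [instance] FiniteFreeResolution.addCommGroup FiniteFreeResolution.module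

/-- `Tr Ω^n M`: the transpose of the `n`-th syzygy of `M` with respect to the given
finite free resolution, i.e. the cokernel of the dual map `F_n^* → F_{n+1}^*`.
(For `n = 0` this is the transpose `Tr M` of `M` itself.) -/
abbrev FiniteFreeResolution.trSyzygy {R : Type} [CommRing R] {M : Type}
    [AddCommGroup M] [Module R M] (res : FiniteFreeResolution R M) (n : ℕ) : Type :=
  Module.Dual R (res.F (n + 1)) ⧸ LinearMap.range (res.d n).dualMap

open Limits MonoidalCategory

/-- The homology `ker g / (ker g ∩ im f)` at the middle term of `A → B → C`. -/
abbrev LinearMap.homologyQuot {R A B C : Type*} [CommRing R] [AddCommGroup A] [AddCommGroup B]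
    [AddCommGroup C] [Module R A] [Module R B] [Module R C] (f : A →ₗ[R] B) (g : B →ₗ[R] C) :
    Type _ :=
  LinearMap.ker g ⧸ (LinearMap.range f).submoduleOf (LinearMap.ker g)

/-- An equivalence of the middle terms matching kernels and images induces an equivalence in
homology. -/
noncomputable def LinearMap.homologyQuotCongr {R A B C A' B' C' : Type*} [CommRing R]
    [AddCommGroup A] [AddCommGroup B] [AddCommGroup C] [Module R A] [Module R B] [Module R C]
    [AddCommGroup A'] [AddCommGroup B'] [AddCommGroup C'] [Module R A'] [Module R B'] [Module R C']
    {f : A →ₗ[R] B} {g : B →ₗ[R] C} {f' : A' →ₗ[R] B'} {g' : B' →ₗ[R] C'} (e : B ≃ₗ[R] B')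
    (hg : ∀ b, g b = 0 ↔ g' (e b) = 0) (hf : ∀ b, b ∈ range f ↔ e b ∈ range f') :
    f.homologyQuot g ≃ₗ[R] f'.homologyQuot g' := by
  have hk : (ker g).map (e : B →ₗ[R] B') = ker g' := by
    ext x
    obtain ⟨b, rfl⟩ := e.surjective x
    simp [hg]
  refine Submodule.Quotient.equiv _ _ (e.ofSubmodules _ _ hk) ?_
  ext ⟨x, hx⟩
  obtain ⟨b, rfl⟩ := e.surjective x
  rw [Submodule.mem_map]
  constructor
  · rintro ⟨y, hy, h⟩
    obtain rfl : (y : B) = b := e.injective (congrArg Subtype.val h)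
    exact (hf _).1 hy
  · exact fun h => ⟨⟨b, (hg b).2 hx⟩, (hf b).2 h, rfl⟩

/-- The homology of a short complex of modules is the quotient of the kernel by the image. -/
noncomputable def CategoryTheory.ShortComplex.homologyEquivHomologyQuot {R : Type} [CommRing R]
    (S : ShortComplex (ModuleCat.{0} R)) : S.homology ≃ₗ[R] S.f.hom.homologyQuot S.g.hom :=
  S.moduleCatHomologyIso.toLinearEquiv ≪≫ₗ
    Submodule.quotEquivOfEq _ _ (by
      ext ⟨x, hx⟩
      simp only [Submodule.submoduleOf, Submodule.mem_comap, LinearMap.mem_range]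
      exact exists_congr fun a => Subtype.ext_iff)

namespace CategoryTheory.ProjectiveResolution

/-- An exact complex of projectives augmented by an epimorphism is a projective resolution. -/
noncomputable def ofExact {C : Type*} [Category* C] [Abelian C] {Z : C} (K : ChainComplex C ℕ)
    (hK : ∀ n, Projective (K.X n)) (ε : K.X 0 ⟶ Z) [Epi ε] (w : K.d 1 0 ≫ ε = 0)
    (h₀ : (ShortComplex.mk _ _ w).Exact) (h : ∀ n, K.ExactAt (n + 1)) :
    ProjectiveResolution Z where
  complex := K
  π := (ChainComplex.toSingle₀Equiv _ _).symm ⟨ε, w⟩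
  quasiIso := ⟨fun n => by
    cases n
    · rw [ChainComplex.quasiIsoAt₀_iff, ShortComplex.quasiIso_iff_of_zeros']
      · refine (ShortComplex.exact_and_epi_g_iff_of_iso ?_).2 ⟨h₀, by dsimp; infer_instance⟩
        refine ShortComplex.isoMk (Iso.refl _) (Iso.refl _) (Iso.refl _) ?_ ?_
        · exact (Category.id_comp _).trans (Category.comp_id _).symm
        · refine (Category.id_comp _).trans (Eq.trans ?_ (Category.comp_id _).symm)
          exact (ChainComplex.toSingle₀Equiv_symm_apply_f_zero ε w).symm
      · exact K.shape _ _ (by simp)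
      all_goals rfl
    · rw [quasiIsoAt_iff_exactAt']
      · apply h
      · apply ChainComplex.exactAt_succ_single_obj⟩

/-- `Ext^{n+1}` as the homology of the complex of homomorphisms out of a projective
resolution. -/
lemma nonempty_ext_succ_equiv {R : Type} [CommRing R] {X : ModuleCat.{0} R}
    (P : ProjectiveResolution X) (n : ℕ) (Y : ModuleCat.{0} R) :
    Nonempty ((((Ext R (ModuleCat R) (n + 1)).obj (Opposite.op X)).obj Y) ≃ₗ[R]
      LinearMap.homologyQuot
        (LinearMap.lcomp R Y (P.complex.d (n + 1) n).hom)
        (LinearMap.lcomp R Y (P.complex.d (n + 2) (n + 1)).hom)) := by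
  let L := P.complex.linearYonedaObj R Y
  let i : L.homology (n + 1) ≅ (L.sc' n (n + 1) (n + 2)).homology :=
    ShortComplex.homologyMapIso (L.isoSc' n (n + 1) (n + 2) (by simp) (by simp))
  let j := P.isoExt (R := R) (n + 1) Y
  refine ⟨(j ≪≫ i).toLinearEquiv ≪≫ₗ ShortComplex.homologyEquivHomologyQuot _ ≪≫ₗ
    LinearMap.homologyQuotCongr ModuleCat.homLinearEquiv ?_ ?_⟩
  · intro b
    have : L.d (n + 1) (n + 2) b = P.complex.d (n + 2) (n + 1) ≫ b := rfl
    change L.d (n + 1) (n + 2) b = 0 ↔ _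
    rw [this]
    exact ModuleCat.hom_ext_iff
  · intro b
    constructor
    · rintro ⟨a, rfl⟩
      exact ⟨a.hom, rfl⟩
    · rintro ⟨a, ha⟩
      exact ⟨ModuleCat.ofHom a, ModuleCat.hom_ext ha⟩

/-- The complex with terms `X n` is exact in positive degrees if its differentials are exact. -/
lemma _root_.ChainComplex.of_exactAt_succ {C : Type*} [Category* C] [Abelian C] (X : ℕ → C)
    (d : ∀ n, X (n + 1) ⟶ X n) (w : ∀ n, d (n + 1) ≫ d n = 0) (n : ℕ)
    (h : (ShortComplex.mk _ _ (w n)).Exact) : (ChainComplex.of X d w).ExactAt (n + 1) := by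
  rw [HomologicalComplex.exactAt_iff' _ (n + 1 + 1) (n + 1) n (by simp) (by simp)]
  refine (ShortComplex.exact_iff_of_iso ?_).1 h
  refine ShortComplex.isoMk (Iso.refl _) (Iso.refl _) (Iso.refl _) ?_ ?_
  · refine (Category.id_comp _).trans (Eq.trans ?_ (Category.comp_id _).symm)
    exact ChainComplex.of_d X d (n + 1)
  · refine (Category.id_comp _).trans (Eq.trans ?_ (Category.comp_id _).symm)
    exact ChainComplex.of_d X d n

lemma projective_d_comp {C : Type*} [Category* C] [Abelian C] [EnoughProjectives C] {X Y : C}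
    (f : X ⟶ Y) : Projective.d f ≫ f = 0 :=
  (Category.assoc _ _ _).trans ((congrArg _ (kernel.condition f)).trans comp_zero)

/-- The successive projective covers of kernels starting from an arrow. -/
noncomputable def syzygyArrow {C : Type*} [Category* C] [Abelian C] [EnoughProjectives C]
    (f : Arrow C) : ℕ → Arrow C
  | 0 => f
  | n + 1 => Arrow.mk (Projective.d (syzygyArrow f n).hom)

/-- A projective resolution from a sequence of morphisms. -/
noncomputable def ofSeq {C : Type*} [Category* C] [Abelian C] {Z : C} (X : ℕ → C)
    (hX : ∀ n, Projective (X n)) (d : ∀ n, X (n + 1) ⟶ X n) (w : ∀ n, d (n + 1) ≫ d n = 0)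
    (ε : X 0 ⟶ Z) [Epi ε] (w₀ : d 0 ≫ ε = 0)
    (h₀ : (ShortComplex.mk _ _ w₀).Exact) (h : ∀ n, (ShortComplex.mk _ _ (w n)).Exact) :
    ProjectiveResolution Z :=
  have hd : (ChainComplex.of X d w).d 1 0 = d 0 := ChainComplex.of_d X d 0
  have hε : (ChainComplex.of X d w).d 1 0 ≫ (show (ChainComplex.of X d w).X 0 ⟶ Z from ε) = 0 :=
    (congrArg (· ≫ ε) hd).trans w₀
  @ofExact C _ _ Z (ChainComplex.of X d w) hX ε ‹Epi ε› hε
    ((ShortComplex.exact_iff_of_iso (ShortComplex.isoMk (S₁ := .mk _ _ w₀) (S₂ := .mk _ _ hε)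
      (Iso.refl _) (Iso.refl _) (Iso.refl _)
      ((Category.id_comp _).trans (hd.trans (Category.comp_id _).symm))
      ((Category.id_comp _).trans (Category.comp_id _).symm))).1 h₀)
    (fun n => ChainComplex.of_exactAt_succ X d w n (h n))

lemma ofSeq_d {C : Type*} [Category* C] [Abelian C] {Z : C} (X : ℕ → C)
    (hX : ∀ n, Projective (X n)) (d : ∀ n, X (n + 1) ⟶ X n) (w : ∀ n, d (n + 1) ≫ d n = 0)
    (ε : X 0 ⟶ Z) [Epi ε] (w₀ : d 0 ≫ ε = 0)
    (h₀ : (ShortComplex.mk _ _ w₀).Exact) (h : ∀ n, (ShortComplex.mk _ _ (w n)).Exact) (n : ℕ) :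
    (ofSeq X hX d w ε w₀ h₀ h).complex.d (n + 1) n = d n :=
  ChainComplex.of_d X d n

/-- A projective resolution starting with a given presentation. -/
noncomputable def ofPresentation {C : Type*} [Category* C] [Abelian C] [EnoughProjectives C]
    {X₀ X₁ Z : C} [hX₀ : Projective X₀] [hX₁ : Projective X₁] (d : X₁ ⟶ X₀) (ε : X₀ ⟶ Z)
    [hε : Epi ε] (w : d ≫ ε = 0) (h₀ : (ShortComplex.mk _ _ w).Exact) : ProjectiveResolution Z :=
  @ofSeq C _ _ Z (fun n => (syzygyArrow (Arrow.mk d) n).right)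
    (by
      rintro (_ | _ | n)
      · exact hX₀
      · exact hX₁
      · exact Projective.projective_over _)
    (fun n => (syzygyArrow (Arrow.mk d) n).hom)
    (fun n => projective_d_comp _)
    ε hε w h₀ (fun n => exact_d_f _)

lemma ofPresentation_d {C : Type*} [Category* C] [Abelian C] [EnoughProjectives C]
    {X₀ X₁ Z : C} [Projective X₀] [Projective X₁] (d : X₁ ⟶ X₀) (ε : X₀ ⟶ Z)
    [Epi ε] (w : d ≫ ε = 0) (h₀ : (ShortComplex.mk _ _ w).Exact) :
    (ofPresentation d ε w h₀).complex.d 1 0 = d :=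
  ChainComplex.of_d (fun n => (syzygyArrow (Arrow.mk d) n).right)
    (fun n => (syzygyArrow (Arrow.mk d) n).hom) 0

end CategoryTheory.ProjectiveResolution

section Ext

variable {R : Type} [CommRing R]

/-- `Ext^1(T, N)` in terms of a projective presentation `P₁ → P₀ → T → 0`. -/
lemma nonempty_ext_one_equiv_of_presentation {P₁ P₀ T N : Type}
    [AddCommGroup P₁] [AddCommGroup P₀] [AddCommGroup T] [AddCommGroup N]
    [Module R P₁] [Module R P₀] [Module R T] [Module R N]
    [Module.Projective R P₁] [Module.Projective R P₀]
    (d : P₁ →ₗ[R] P₀) (ε : P₀ →ₗ[R] T) (hε : Function.Surjective ε) (h : Function.Exact d ε) :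
    Nonempty (((((Ext R (ModuleCat R) 1).obj (Opposite.op (ModuleCat.of R T))).obj
        (ModuleCat.of R N) : ModuleCat R)) ≃ₗ[R]
      LinearMap.homologyQuot (LinearMap.lcomp R N d)
        (LinearMap.lcomp R N (LinearMap.ker d).subtype)) := by
  have hε' : Epi (ModuleCat.ofHom ε) := (ModuleCat.epi_iff_surjective _).2 hε
  have w : ModuleCat.ofHom d ≫ ModuleCat.ofHom ε = 0 :=
    ModuleCat.hom_ext (LinearMap.ext fun x => h.apply_apply_eq_zero x)
  have hex : (ShortComplex.mk _ _ w).Exact :=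
    (ShortComplex.ShortExact.moduleCat_exact_iff_function_exact _).2 h
  let P := ProjectiveResolution.ofPresentation _ _ w hex
  have hd : (P.complex.d 1 0) = ModuleCat.ofHom d :=
    ProjectiveResolution.ofPresentation_d _ _ w hex
  obtain ⟨e⟩ := P.nonempty_ext_succ_equiv 0 (ModuleCat.of R N)
  refine ⟨e ≪≫ₗ LinearMap.homologyQuotCongr (B' := P₁ →ₗ[R] N) (.refl R _) ?_ ?_⟩
  · intro b
    have hx := (ShortComplex.ShortExact.moduleCat_exact_iff_function_exact _).1 (P.exact_succ 0)
    constructor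
    · intro hb
      ext ⟨x, hx'⟩
      obtain ⟨y, rfl⟩ := (hx x).1 (by
        change (P.complex.d 1 0).hom x = 0
        rw [hd]
        exact hx')
      exact LinearMap.congr_fun hb y
    · intro hb
      refine LinearMap.ext fun y => ?_
      refine LinearMap.congr_fun hb ⟨(P.complex.d 2 1).hom y, ?_⟩
      have := (hx _).2 ⟨y, rfl⟩
      change (P.complex.d 1 0).hom ((P.complex.d 2 1).hom y) = 0 at this
      rw [hd] at this
      exact this
  · intro b
    change b ∈ LinearMap.range (LinearMap.lcomp R N (P.complex.d 1 0).hom) ↔ _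
    rw [hd]
    rfl

variable {M : Type} [AddCommGroup M] [Module R M]

lemma FiniteFreeResolution.range_dualMap_of_ext (res : FiniteFreeResolution R M) (n : ℕ)
    (hext : Subsingleton (extMod R (n + 1) M R)) :
    LinearMap.range (res.d n).dualMap = LinearMap.ker (res.d (n + 1)).dualMap := by
  have := res.free
  have hε' : Epi (ModuleCat.ofHom res.ε) := (ModuleCat.epi_iff_surjective _).2 res.surj
  let P := ProjectiveResolution.ofSeq (Z := ModuleCat.of R M) (fun n => ModuleCat.of R (res.F n))
    (fun n => inferInstance)
    (fun n => ModuleCat.ofHom (res.d n))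
    (fun n => ModuleCat.hom_ext (LinearMap.ext fun x => (res.exact_at n).apply_apply_eq_zero x))
    (ModuleCat.ofHom res.ε)
    (ModuleCat.hom_ext (LinearMap.ext fun x => res.exact_at_zero.apply_apply_eq_zero x))
    ((ShortComplex.ShortExact.moduleCat_exact_iff_function_exact _).2 res.exact_at_zero)
    (fun n => (ShortComplex.ShortExact.moduleCat_exact_iff_function_exact _).2 (res.exact_at n))
  have hd (n : ℕ) : P.complex.d (n + 1) n = ModuleCat.ofHom (res.d n) :=
    ProjectiveResolution.ofSeq_d ..
  obtain ⟨e⟩ := P.nonempty_ext_succ_equiv n (ModuleCat.of R R)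
  have hs := e.symm.toEquiv.subsingleton
  rw [hd n, hd (n + 1)] at hs
  replace hs := Submodule.Quotient.subsingleton_iff.1 hs
  refine le_antisymm ?_ fun φ hφ => ?_
  · rintro _ ⟨φ, rfl⟩
    ext x
    simp [(res.exact_at n).apply_apply_eq_zero]
  · exact Submodule.submoduleOf_eq_top.1 hs hφ

end Ext

section Tor

variable {R : Type} [CommRing R]

/-- The complex `X ⊗ K`. -/
noncomputable abbrev ChainComplex.tensorWith (X : ModuleCat.{0} R)
    (K : ChainComplex (ModuleCat.{0} R) ℕ) : ChainComplex (ModuleCat.{0} R) ℕ :=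
  (((tensoringLeft (ModuleCat R)).obj X).mapHomologicalComplex _).obj K

/-- `Tor` is computed by a projective resolution of the second argument. -/
noncomputable def CategoryTheory.ProjectiveResolution.torIso {N : ModuleCat.{0} R}
    (P : ProjectiveResolution N) (X : ModuleCat.{0} R) (i : ℕ) :
    ((Tor (ModuleCat R) i).obj X).obj N ≅ (P.complex.tensorWith X).homology i :=
  P.isoLeftDerivedObj ((tensoringLeft (ModuleCat R)).obj X) i

lemma CategoryTheory.ProjectiveResolution.isZero_homology_tensorWith_succ {N : ModuleCat.{0} R}
    (P : ProjectiveResolution N) (X : ModuleCat.{0} R) [Module.Flat R X] (n : ℕ) :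
    IsZero ((P.complex.tensorWith X).homology (n + 1)) := by
  rw [← HomologicalComplex.exactAt_iff_isZero_homology,
    HomologicalComplex.exactAt_iff' _ (n + 2) (n + 1) n (by simp) (by simp)]
  have h := Module.Flat.lTensor_shortComplex_exact X _ (P.exact_succ n)
  exact (ShortComplex.exact_iff_of_iso (Iso.refl _)).1 h

/-- Tensoring a short complex of modules with a chain complex. -/
noncomputable abbrev tensorComplex (S : ShortComplex (ModuleCat.{0} R))
    (K : ChainComplex (ModuleCat.{0} R) ℕ) : ShortComplex (ChainComplex (ModuleCat.{0} R) ℕ) :=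
  ShortComplex.mk
    ((NatTrans.mapHomologicalComplex ((tensoringLeft (ModuleCat R)).map S.f) _).app K)
    ((NatTrans.mapHomologicalComplex ((tensoringLeft (ModuleCat R)).map S.g) _).app K)
    (by
      ext i : 1
      exact (comp_whiskerRight S.f S.g _).symm.trans
        ((congrArg (fun f => f ▷ K.X i) S.zero).trans (MonoidalPreadditive.zero_whiskerRight)))

lemma tensorComplex_shortExact {S : ShortComplex (ModuleCat.{0} R)} (hS : S.ShortExact)
    {N : ModuleCat.{0} R} (P : ProjectiveResolution N) :
    (tensorComplex S P.complex).ShortExact := by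
  refine HomologicalComplex.shortExact_of_degreewise_shortExact _ fun i => ?_
  have : Module.Projective R (P.complex.X i) := ModuleCat.projective_of_module_projective _
  exact hS.map_of_exact (tensorRight (P.complex.X i))

/-- Dimension shifting for `Tor` in the first variable. -/
lemma nonempty_tor_add_two_iso {S : ShortComplex (ModuleCat.{0} R)} (hS : S.ShortExact)
    [Module.Flat R S.X₂] (N : ModuleCat.{0} R) (n : ℕ) :
    Nonempty (((Tor (ModuleCat R) (n + 2)).obj S.X₃).obj N ≅
      ((Tor (ModuleCat R) (n + 1)).obj S.X₁).obj N) := by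
  obtain ⟨P⟩ := HasProjectiveResolution.out (Z := N)
  exact ⟨P.torIso _ _ ≪≫ (tensorComplex_shortExact hS P).δIso (n + 2) (n + 1) (by simp)
    (P.isZero_homology_tensorWith_succ _ _) (P.isZero_homology_tensorWith_succ _ _) ≪≫
    (P.torIso _ _).symm⟩

/-- The degree zero homology of `X ⊗ P` for `P` a projective resolution of `N`. -/
noncomputable def CategoryTheory.ProjectiveResolution.homologyZeroTensorWithIso
    {N : ModuleCat.{0} R} (P : ProjectiveResolution N) (X : ModuleCat.{0} R) :
    (P.complex.tensorWith X).homology 0 ≅ X ⊗ N :=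
  have : PreservesFiniteColimits ((tensoringLeft (ModuleCat R)).obj X) :=
    inferInstanceAs (PreservesFiniteColimits (tensorLeft X))
  ChainComplex.isoHomologyι₀ _ ≪≫ asIso (P.fromLeftDerivedZero' ((tensoringLeft _).obj X))

lemma CategoryTheory.ProjectiveResolution.homologyZeroTensorWithIso_naturality
    {N : ModuleCat.{0} R} (P : ProjectiveResolution N) {X Y : ModuleCat.{0} R} (f : X ⟶ Y) :
    HomologicalComplex.homologyMap ((NatTrans.mapHomologicalComplex
      ((tensoringLeft (ModuleCat R)).map f) _).app P.complex) 0 ≫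
        (P.homologyZeroTensorWithIso Y).hom =
      (P.homologyZeroTensorWithIso X).hom ≫ f ▷ N := by
  let φ : P.complex.tensorWith X ⟶ P.complex.tensorWith Y :=
    (NatTrans.mapHomologicalComplex ((tensoringLeft (ModuleCat R)).map f) _).app P.complex
  have h : HomologicalComplex.opcyclesMap φ 0 ≫
      P.fromLeftDerivedZero' ((tensoringLeft _).obj Y) =
      P.fromLeftDerivedZero' ((tensoringLeft _).obj X) ≫ f ▷ N := by
    rw [← cancel_epi (HomologicalComplex.pOpcycles _ _),
      HomologicalComplex.p_opcyclesMap_assoc, P.pOpcycles_comp_fromLeftDerivedZero',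
      P.pOpcycles_comp_fromLeftDerivedZero'_assoc]
    exact (((tensoringLeft (ModuleCat R)).map f).naturality (P.π.f 0)).symm
  have h' : HomologicalComplex.homologyMap φ 0 ≫ (P.complex.tensorWith Y).homologyι 0 =
    (P.complex.tensorWith X).homologyι 0 ≫ HomologicalComplex.opcyclesMap φ 0 :=
    HomologicalComplex.homologyι_naturality φ 0
  change HomologicalComplex.homologyMap φ 0 ≫ (P.complex.tensorWith Y).homologyι 0 ≫
    P.fromLeftDerivedZero' ((tensoringLeft _).obj Y) =
    ((P.complex.tensorWith X).homologyι 0 ≫ P.fromLeftDerivedZero' ((tensoringLeft _).obj X)) ≫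
      f ▷ N
  rw [reassoc_of% h', h, Category.assoc]

/-- `Tor₁` of a quotient of a flat module. -/
lemma nonempty_tor_one_equiv {S : ShortComplex (ModuleCat.{0} R)} (hS : S.ShortExact)
    [Module.Flat R S.X₂] (N : ModuleCat.{0} R) :
    Nonempty (((Tor (ModuleCat R) 1).obj S.X₃).obj N ≃ₗ[R]
      LinearMap.ker (S.f.hom.rTensor N)) := by
  obtain ⟨P⟩ := HasProjectiveResolution.out (Z := N)
  have h := tensorComplex_shortExact hS P
  let δ := h.δ 1 0 (by simp)
  have hmono : Mono δ := h.mono_δ 1 0 (by simp) (P.isZero_homology_tensorWith_succ _ _)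
  have hnat := P.homologyZeroTensorWithIso_naturality S.f
  let b : ((Tor (ModuleCat R) 1).obj S.X₃).obj N ⟶ S.X₁ ⊗ N :=
    (P.torIso S.X₃ 1).hom ≫ δ ≫ (P.homologyZeroTensorWithIso S.X₁).hom
  have hb : Function.Injective b := (ModuleCat.mono_iff_injective b).1 inferInstance
  have w : b ≫ S.f ▷ N = 0 := by
    simp only [b, Category.assoc, ← hnat]
    rw [reassoc_of% (h.δ_comp 1 0 (by simp)), zero_comp, comp_zero]
  have hex : (ShortComplex.mk b (S.f ▷ N) w).Exact :=
    (ShortComplex.exact_iff_of_iso (ShortComplex.isoMk (P.torIso S.X₃ 1).symm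
      (P.homologyZeroTensorWithIso S.X₁) (P.homologyZeroTensorWithIso S.X₂)
      ((P.torIso S.X₃ 1).inv_hom_id_assoc _) hnat.symm)).1 (h.homology_exact₁ 1 0 (by simp))
  exact ⟨LinearEquiv.ofInjective b.hom hb ≪≫ₗ LinearEquiv.ofEq _ _ hex.moduleCat_range_eq_ker⟩

/-- A quotient map identifies the homology of a factored map with a kernel. -/
lemma nonempty_ker_equiv_homologyQuot {A B K C : Type*} [AddCommGroup A] [AddCommGroup B]
    [AddCommGroup K] [AddCommGroup C] [Module R A] [Module R B] [Module R K] [Module R C]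
    {f : A →ₗ[R] B} {q : B →ₗ[R] K} (i : K →ₗ[R] C) (hq : Function.Surjective q)
    (h : Function.Exact f q) :
    Nonempty (LinearMap.ker i ≃ₗ[R] f.homologyQuot (i ∘ₗ q)) := by
  let p : LinearMap.ker (i ∘ₗ q) →ₗ[R] LinearMap.ker i := q.restrict fun x hx => hx
  have hp : Function.Surjective p := by
    rintro ⟨y, hy⟩
    obtain ⟨x, rfl⟩ := hq y
    exact ⟨⟨x, hy⟩, rfl⟩
  refine ⟨((Submodule.quotEquivOfEq _ _ ?_) ≪≫ₗ p.quotKerEquivOfSurjective hp).symm⟩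
  ext ⟨x, hx⟩
  rw [LinearMap.mem_ker]
  exact (h x).symm.trans (Subtype.ext_iff (a1 := p ⟨x, hx⟩) (a2 := 0)).symm

/-- The resolution of the first syzygy obtained by dropping the zeroth term. -/
def FiniteFreeResolution.tail {M : Type} [AddCommGroup M] [Module R M]
    (res : FiniteFreeResolution R M) : FiniteFreeResolution R (LinearMap.ker res.ε) where
  F n := res.F (n + 1)
  free n := res.free (n + 1)
  finite n := res.finite (n + 1)
  d n := res.d (n + 1)
  ε := (res.d 0).codRestrict _ fun x => res.exact_at_zero.apply_apply_eq_zero x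
  surj := by
    rintro ⟨x, hx⟩
    obtain ⟨y, rfl⟩ := (res.exact_at_zero x).1 hx
    exact ⟨y, rfl⟩
  exact_at_zero x := Subtype.ext_iff.trans (res.exact_at 0 x)
  exact_at n := res.exact_at (n + 1)

/-- The homology of `F_{n+2} ⊗ N → F_{n+1} ⊗ N → F_n ⊗ N` computes `Tor_{n+1}(M, N)`. -/
lemma FiniteFreeResolution.nonempty_tor_succ_equiv {M : Type} [AddCommGroup M] [Module R M]
    (res : FiniteFreeResolution R M) (N : Type) [AddCommGroup N] [Module R N] (n : ℕ) :
    Nonempty (torMod R (n + 1) M N ≃ₗ[R]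
      LinearMap.homologyQuot ((res.d (n + 1)).rTensor N) ((res.d n).rTensor N)) := by
  have hS := LinearMap.shortExact_shortComplexKer res.surj
  have := res.free 0
  have : Module.Flat R (LinearMap.shortComplexKer res.ε).X₂ :=
    inferInstanceAs (Module.Flat R (res.F 0))
  induction n generalizing M with
  | zero =>
    obtain ⟨e⟩ := nonempty_tor_one_equiv hS (ModuleCat.of R N)
    obtain ⟨e'⟩ := nonempty_ker_equiv_homologyQuot ((LinearMap.ker res.ε).subtype.rTensor N)
      (LinearMap.rTensor_surjective N res.tail.surj)
      (rTensor_exact N res.tail.exact_at_zero res.tail.surj)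
    rw [← LinearMap.rTensor_comp] at e'
    exact ⟨e ≪≫ₗ e'⟩
  | succ n ih =>
    obtain ⟨e⟩ := nonempty_tor_add_two_iso hS (ModuleCat.of R N) n
    have := res.free 1
    obtain ⟨e'⟩ := ih res.tail (LinearMap.shortExact_shortComplexKer res.tail.surj)
      (res.tail.free 0) (inferInstanceAs (Module.Flat R (res.F 1)))
    exact ⟨e.toLinearEquiv ≪≫ₗ e'⟩

end Tor

section TensorDual

variable {R F G : Type*} (N : Type*) [CommRing R] [AddCommGroup F] [Module R F]
  [Module.Projective R F] [Module.Finite R F] [AddCommGroup G] [Module R G]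
  [Module.Projective R G] [Module.Finite R G] [AddCommGroup N] [Module R N]

variable (R F) in
/-- The natural isomorphism `F ⊗ N ≃ Hom(F^*, N)` for `F` finite projective. -/
noncomputable def tensorEquivDualHom : TensorProduct R F N ≃ₗ[R] (Module.Dual R F →ₗ[R] N) :=
  (Module.evalEquiv R F).rTensor N ≪≫ₗ dualTensorHomEquiv R (Module.Dual R F) N

lemma tensorEquivDualHom_tmul (x : F) (y : N) (φ : Module.Dual R F) :
    tensorEquivDualHom R F N (x ⊗ₜ y) φ = φ x • y := by
  simp [tensorEquivDualHom]

lemma tensorEquivDualHom_rTensor (f : F →ₗ[R] G) (t : TensorProduct R F N) :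
    tensorEquivDualHom R G N (f.rTensor N t) = tensorEquivDualHom R F N t ∘ₗ f.dualMap := by
  induction t with
  | zero => simp
  | add s t hs ht => simp [hs, ht, LinearMap.add_comp]
  | tmul x y => ext φ; simp [tensorEquivDualHom_tmul]

end TensorDual

/-- If `n ≥ 1` and `Ext^n_R(M, R) = 0`, then `Tor_n^R(M, N) ≅ Ext^1_R(Tr Ω^n M, N)`. -/
theorem tor_iso_ext_one_trSyzygy_of_ext_vanishing
    (R : Type) [CommRing R] [IsNoetherianRing R] [IsLocalRing R]
    (M N : Type) [AddCommGroup M] [Module R M] [AddCommGroup N] [Module R N]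
    [Module.Finite R M] [Module.Finite R N]
    (res : FiniteFreeResolution R M) (n : ℕ) (hn : 1 ≤ n)
    (hext : Subsingleton (extMod R n M R)) :
    Nonempty (torMod R n M N ≃ₗ[R] extMod R 1 (res.trSyzygy n) N) := by
  obtain ⟨m, rfl⟩ := Nat.exists_eq_add_of_le' hn
  have := res.free
  have := res.finite
  obtain ⟨e⟩ := res.nonempty_tor_succ_equiv N m
  obtain ⟨e'⟩ := nonempty_ext_one_equiv_of_presentation (N := N) (res.d (m + 1)).dualMap
    (LinearMap.range (res.d (m + 1)).dualMap).mkQ (Submodule.mkQ_surjective _)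
    (LinearMap.exact_map_mkQ_range _)
  refine ⟨e ≪≫ₗ LinearMap.homologyQuotCongr (tensorEquivDualHom R (res.F (m + 1)) N) ?_ ?_ ≪≫ₗ
    e'.symm⟩
  · intro t
    rw [← (tensorEquivDualHom R (res.F m) N).map_eq_zero_iff, tensorEquivDualHom_rTensor,
      ← res.range_dualMap_of_ext m hext]
    constructor
    · intro h
      ext ⟨_, φ, rfl⟩
      exact LinearMap.congr_fun h φ
    · intro h
      exact LinearMap.ext fun φ => LinearMap.congr_fun h ⟨_, φ, rfl⟩
  · intro t
    rw [LinearMap.mem_range, LinearMap.mem_range,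
      (tensorEquivDualHom R (res.F (m + 1 + 1)) N).surjective.exists]
    refine exists_congr fun s => ?_
    rw [LinearMap.lcomp_apply', ← tensorEquivDualHom_rTensor, EmbeddingLike.apply_eq_iff_eq]
end

section
/- Let R be a commutative Noetherian local ring, let M and N be nonzero finitely generated R-modules, and let Tr M be the transpose of M associated to a finite free presentation of M. If Ext^i_R(Tr M, N) = 0 for all i ≥ 1, then M ⊗_R N ≅ Hom_R(M^*, N) and depth_R(M ⊗_R N) = depth_R(N). -/
open CategoryTheory

/-- The depth of a module over a local ring: the supremum of the lengths of
`M`-regular sequences contained in the maximal ideal of `R`. -/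
noncomputable def moduleDepth (R : Type) [CommRing R] [IsLocalRing R]
    (M : Type) [AddCommGroup M] [Module R M] : ℕ :=
  sSup {n : ℕ | ∃ rs : List R, rs.length = n ∧
    (∀ r ∈ rs, r ∈ IsLocalRing.maximalIdeal R) ∧ RingTheory.Sequence.IsRegular M rs}

/-- A finite free presentation `P_1 → P_0 → M → 0` of `M`. -/
structure FiniteFreePresentation (R : Type) [CommRing R]
    (M : Type) [AddCommGroup M] [Module R M] where
  P1 : Type
  P0 : Type
  [addCommGroup1 : AddCommGroup P1]
  [addCommGroup0 : AddCommGroup P0]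
  [module1 : Module R P1]
  [module0 : Module R P0]
  free1 : Module.Free R P1
  free0 : Module.Free R P0
  finite1 : Module.Finite R P1
  finite0 : Module.Finite R P0
  f : P1 →ₗ[R] P0
  ε : P0 →ₗ[R] M
  surj : Function.Surjective ε
  exact_at : Function.Exact f ε

attribute [instance] FiniteFreePresentation.addCommGroup1 FiniteFreePresentation.addCommGroup0
  FiniteFreePresentation.module1 FiniteFreePresentation.module0

/-- The transpose `Tr M` of `M` associated to a finite free presentation, i.e. the
cokernel of the dual map `P_0^* → P_1^*`. -/
abbrev FiniteFreePresentation.tr {R : Type} [CommRing R] {M : Type}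
    [AddCommGroup M] [Module R M] (pr : FiniteFreePresentation R M) : Type :=
  Module.Dual R pr.P1 ⧸ LinearMap.range pr.f.dualMap

open Abelian RingTheory.Sequence IsLocalRing Pointwise

universe u

section ExtVanishing

variable {R : Type u} [CommRing R]

/-- All the modules `Ext^i_R(X, Y)` with `i ≥ 1` vanish. -/
def ExtVanishes (R : Type u) [CommRing R] (X Y : Type u) [AddCommGroup X] [Module R X]
    [AddCommGroup Y] [Module R Y] : Prop :=
  ∀ i : ℕ, Subsingleton (Abelian.Ext (ModuleCat.of R X) (ModuleCat.of R Y) (i + 1))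

/-- Vanishing of the derived functor `Ext` implies vanishing of `Ext` in the derived category. -/
lemma subsingleton_abelianExt_of_subsingleton_ext (X Y : ModuleCat.{u} R) (n : ℕ)
    (h : Subsingleton (((Ext R (ModuleCat R) (n + 1)).obj (Opposite.op X)).obj Y)) :
    Subsingleton (Abelian.Ext X Y (n + 1)) := by
  let P := projectiveResolution X
  have hz : Limits.IsZero ((P.complex.linearYonedaObj R Y).homology (n + 1)) :=
    (ModuleCat.isZero_of_subsingleton _).of_iso (P.isoExt (n + 1) Y).symm
  rw [← HomologicalComplex.exactAt_iff_isZero_homology,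
    HomologicalComplex.exactAt_iff' _ n (n + 1) (n + 2) (by simp) (by simp),
    ShortComplex.moduleCat_exact_iff] at hz
  refine subsingleton_of_forall_eq 0 fun α ↦ ?_
  obtain ⟨f, hf, rfl⟩ := P.extMk_surjective α (n + 2) rfl
  rw [P.extMk_eq_zero_iff f (n + 2) rfl hf n rfl]
  exact hz f hf

variable {A B C : Type u} [AddCommGroup A] [Module R A] [AddCommGroup B] [Module R B]
  [AddCommGroup C] [Module R C] {i : A →ₗ[R] B} {q : B →ₗ[R] C}
  {N : Type u} [AddCommGroup N] [Module R N]

lemma ExtVanishes.exists_extension (h : ExtVanishes R C N) (hi : Function.Injective i)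
    (hq : Function.Surjective q) (hiq : Function.Exact i q) (φ : A →ₗ[R] N) :
    ∃ ψ : B →ₗ[R] N, ψ ∘ₗ i = φ := by
  have hS : (ModuleCat.shortComplexOfCompEqZero i q hiq.linearMap_comp_eq_zero).ShortExact :=
    ModuleCat.shortComplex_shortExact _ hiq hi hq
  obtain ⟨x, hx⟩ := Ext.contravariant_sequence_exact₁ hS _
    (Ext.mk₀ (ModuleCat.ofHom φ)) rfl ((h 0).elim _ _)
  obtain ⟨g, rfl⟩ := Ext.addEquiv₀.symm.surjective x
  refine ⟨g.hom, ?_⟩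
  rw [Ext.addEquiv₀_symm_apply, Ext.mk₀_comp_mk₀] at hx
  exact congrArg ModuleCat.Hom.hom (Ext.addEquiv₀.symm.injective hx)

lemma ExtVanishes.of_shortExact_of_projective [Module.Projective R B] (h : ExtVanishes R C N)
    (hi : Function.Injective i) (hq : Function.Surjective q) (hiq : Function.Exact i q) :
    ExtVanishes R A N := by
  intro n
  have hS : (ModuleCat.shortComplexOfCompEqZero i q hiq.linearMap_comp_eq_zero).ShortExact :=
    ModuleCat.shortComplex_shortExact _ hiq hi hq
  refine subsingleton_of_forall_eq 0 fun x ↦ ?_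
  obtain ⟨y, rfl⟩ := Ext.contravariant_sequence_exact₁ hS _ x (add_comm 1 (n + 1))
    ((h (n + 1)).elim _ _)
  have : Projective (ModuleCat.of R B) := ModuleCat.projective_of_categoryTheory_projective _
  rw [Ext.eq_zero_of_projective (P := ModuleCat.of R B) y, Ext.comp_zero]

lemma LinearMap.exists_comp_eq_of_ker_le (hq : Function.Surjective q) {φ : B →ₗ[R] N}
    (hφ : LinearMap.ker q ≤ LinearMap.ker φ) : ∃ ψ : C →ₗ[R] N, ψ ∘ₗ q = φ := by
  refine ⟨(LinearMap.ker q).liftQ φ hφ ∘ₗ (q.quotKerEquivOfSurjective hq).symm.toLinearMap, ?_⟩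
  ext x
  have hx : (q.quotKerEquivOfSurjective hq).symm (q x) = Submodule.Quotient.mk x := by
    rw [LinearEquiv.symm_apply_eq]; rfl
  simp [hx]

lemma ExtVanishes.exists_comp_eq {g : A →ₗ[R] B} (h : ExtVanishes R (B ⧸ LinearMap.range g) N)
    {φ : A →ₗ[R] N} (hφ : LinearMap.ker g ≤ LinearMap.ker φ) : ∃ ψ : B →ₗ[R] N, ψ ∘ₗ g = φ := by
  obtain ⟨k, rfl⟩ := LinearMap.exists_comp_eq_of_ker_le g.surjective_rangeRestrict
    (φ := φ) (by rwa [LinearMap.ker_rangeRestrict])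
  obtain ⟨l, rfl⟩ := h.exists_extension (LinearMap.range g).injective_subtype
    (LinearMap.range g).mkQ_surjective (LinearMap.exact_subtype_mkQ _) k
  exact ⟨l, rfl⟩

variable {x : R}

lemma ExtVanishes.quotSMulTop (h : ExtVanishes R A N) (hx : IsSMulRegular N x) :
    ExtVanishes R A (QuotSMulTop x N) := by
  intro n
  refine subsingleton_of_forall_eq 0 fun α ↦ ?_
  obtain ⟨β, rfl⟩ := Ext.covariant_sequence_exact₃ _
    (IsSMulRegular.smulShortComplex_shortExact (M := ModuleCat.of R N) hx) α rfl
    ((h (n + 1)).elim _ _)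
  have hβ : β = 0 := (h n).elim _ _
  rw [hβ, Ext.zero_comp]
  rfl

lemma ExtVanishes.exists_lift_mkQ (h : ExtVanishes R A N) (hx : IsSMulRegular N x)
    (φ : A →ₗ[R] QuotSMulTop x N) :
    ∃ ψ : A →ₗ[R] N, (x • (⊤ : Submodule R N)).mkQ ∘ₗ ψ = φ := by
  obtain ⟨y, hy⟩ := Ext.covariant_sequence_exact₃ _
    (IsSMulRegular.smulShortComplex_shortExact (M := ModuleCat.of R N) hx)
    (Ext.mk₀ (ModuleCat.ofHom φ)) rfl ((h 0).elim _ _)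
  obtain ⟨g, rfl⟩ := Ext.addEquiv₀.symm.surjective y
  refine ⟨g.hom, ?_⟩
  rw [Ext.addEquiv₀_symm_apply, Ext.mk₀_comp_mk₀] at hy
  exact congrArg ModuleCat.Hom.hom (Ext.addEquiv₀.symm.injective hy)

lemma IsSMulRegular.linearMap (A : Type u) [AddCommGroup A] [Module R A]
    (hx : IsSMulRegular N x) : IsSMulRegular (A →ₗ[R] N) x := fun _ _ hfg ↦
  LinearMap.ext fun a ↦ hx (LinearMap.congr_fun hfg a)

/-- If `x` is `N`-regular and `Ext^i(A, N) = 0` for `i ≥ 1`, then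
`Hom(A, N) / x Hom(A, N) ≃ Hom(A, N / xN)`. -/
lemma ExtVanishes.nonempty_quotSMulTop_linearMap_equiv (h : ExtVanishes R A N)
    (hx : IsSMulRegular N x) :
    Nonempty (QuotSMulTop x (A →ₗ[R] N) ≃ₗ[R] (A →ₗ[R] QuotSMulTop x N)) := by
  let p : (A →ₗ[R] N) →ₗ[R] (A →ₗ[R] QuotSMulTop x N) :=
    LinearMap.compRight R (x • (⊤ : Submodule R N)).mkQ
  have hp : Function.Surjective p := h.exists_lift_mkQ hx
  have hker : x • (⊤ : Submodule R (A →ₗ[R] N)) = LinearMap.ker p := by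
    apply le_antisymm
    · rintro _ ⟨f, -, rfl⟩
      refine LinearMap.ext fun a ↦ ?_
      exact (Submodule.Quotient.mk_eq_zero _).mpr
        (Submodule.smul_mem_pointwise_smul (f a) x ⊤ trivial)
    · intro f hf
      have hf' : ∀ a, ∃ b, x • b = f a := fun a ↦ by
        have := (Submodule.Quotient.mk_eq_zero _).mp (LinearMap.congr_fun hf a)
        obtain ⟨b, -, hb⟩ := this
        exact ⟨b, hb⟩
      choose g hg using hf'
      refine ⟨{ toFun := g, map_add' := fun _ _ ↦ hx ?_, map_smul' := fun r _ ↦ hx ?_ },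
        trivial, LinearMap.ext hg⟩
      · simp [hg]
      · simp [hg, smul_comm x r]
  exact ⟨Submodule.quotEquivOfEq _ _ hker ≪≫ₗ p.quotKerEquivOfSurjective hp⟩

end ExtVanishing

section RegularSequences

variable {R : Type u} [CommRing R] [IsLocalRing R]

/-- There is an `L`-regular sequence of length `n` in the maximal ideal of `R`. -/
def HasRegularSequence (R : Type u) [CommRing R] [IsLocalRing R] (n : ℕ)
    (L : Type u) [AddCommGroup L] [Module R L] : Prop :=
  ∃ rs : List R, rs.length = n ∧ (∀ r ∈ rs, r ∈ maximalIdeal R) ∧ IsRegular L rs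

variable {L L' : Type u} [AddCommGroup L] [Module R L] [AddCommGroup L'] [Module R L']

lemma HasRegularSequence.congr (e : L ≃ₗ[R] L') (n : ℕ) :
    HasRegularSequence R n L ↔ HasRegularSequence R n L' :=
  exists_congr fun rs ↦ by rw [e.isRegular_congr rs]

lemma hasRegularSequence_zero [Nontrivial L] : HasRegularSequence R 0 L :=
  ⟨[], rfl, by simp, IsRegular.nil R L⟩

lemma hasRegularSequence_succ_iff (n : ℕ) : HasRegularSequence R (n + 1) L ↔
    ∃ x ∈ maximalIdeal R, IsSMulRegular L x ∧ HasRegularSequence R n (QuotSMulTop x L) := by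
  constructor
  · rintro ⟨_ | ⟨x, rs⟩, hl, hm, hr⟩
    · simp at hl
    · rw [isRegular_cons_iff] at hr
      exact ⟨x, hm x (by simp), hr.1, rs, by simpa using hl,
        fun r h ↦ hm r (by simp [h]), hr.2⟩
  · rintro ⟨x, hxm, hx, rs, hl, hm, hr⟩
    exact ⟨x :: rs, by simp [hl], List.forall_mem_cons.mpr ⟨hxm, hm⟩, hr.cons hx⟩

lemma maximalIdeal_smul_top_lt_top [Module.Finite R L] [Nontrivial L] :
    maximalIdeal R • (⊤ : Submodule R L) < ⊤ :=
  (Submodule.top_ne_ideal_smul_of_le_jacobson_annihilator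
    (maximalIdeal_le_jacobson _)).symm.lt_top

variable [IsNoetherianRing R]

/-- Every regular element of the maximal ideal starts a regular sequence of maximal length. -/
lemma HasRegularSequence.quotSMulTop [Module.Finite R L] [Nontrivial L] {n : ℕ}
    (h : HasRegularSequence R (n + 1) L) {x : R} (hxm : x ∈ maximalIdeal R)
    (hx : IsSMulRegular L x) : HasRegularSequence R n (QuotSMulTop x L) := by
  have : Nontrivial (QuotSMulTop x L) := nontrivial_quotSMulTop_of_mem_maximalIdeal L hxm
  have hL := ((ModuleCat.exists_isRegular_tfae (maximalIdeal R) (n + 1) (ModuleCat.of R L)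
    maximalIdeal_smul_top_lt_top).out 3 1).mp h
  refine ((ModuleCat.exists_isRegular_tfae (maximalIdeal R) n
    (ModuleCat.of R (QuotSMulTop x L)) maximalIdeal_smul_top_lt_top).out 1 3).mp fun i hi ↦ ?_
  refine subsingleton_of_forall_eq 0 fun α ↦ ?_
  obtain ⟨β, rfl⟩ := Ext.covariant_sequence_exact₃ _
    (IsSMulRegular.smulShortComplex_shortExact (M := ModuleCat.of R L) hx) α rfl
    ((hL (i + 1) (by lia)).elim _ _)
  have hβ : β = 0 := (hL i (by lia)).elim _ _
  rw [hβ, Ext.zero_comp]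
  rfl

variable {X N : Type u} [AddCommGroup X] [Module R X] [Module.Finite R X]
  [AddCommGroup N] [Module R N] [Module.Finite R N]

lemma exists_isSMulRegular_of_isSMulRegular_linearMap [Nontrivial X] {x : R}
    (hxm : x ∈ maximalIdeal R) (hx : IsSMulRegular (X →ₗ[R] N) x) :
    ∃ y ∈ maximalIdeal R, IsSMulRegular N y := by
  let S := X ⧸ maximalIdeal R • (⊤ : Submodule R X)
  have hS : Nontrivial S :=
    Submodule.Quotient.nontrivial_iff.mpr maximalIdeal_smul_top_lt_top.ne
  have : Subsingleton (S →ₗ[R] N) := by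
    refine subsingleton_of_forall_eq 0 fun g ↦ ?_
    have hg : g ∘ₗ Submodule.mkQ _ = 0 := by
      refine hx (LinearMap.ext fun a ↦ ?_)
      have : (Submodule.mkQ (maximalIdeal R • (⊤ : Submodule R X))) (x • a) = 0 :=
        (Submodule.Quotient.mk_eq_zero _).mpr (Submodule.smul_mem_smul hxm trivial)
      change x • g (Submodule.mkQ _ a) = x • (0 : N)
      rw [smul_zero, ← map_smul, ← map_smul, this, map_zero]
    exact Submodule.linearMap_qext _ hg
  obtain ⟨y, hyS, hy⟩ := IsSMulRegular.subsingleton_linearMap_iff.mp this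
  refine ⟨y, (mem_maximalIdeal y).mpr fun hu ↦ ?_, hy⟩
  obtain ⟨s, hs⟩ := exists_ne (0 : S)
  exact hs (hu.smul_eq_zero.mp (Module.mem_annihilator.mp hyS s))

/-- If `Ext^i(X, N) = 0` for `i ≥ 1` and `Hom(X, N) ≠ 0`, then `N` and `Hom(X, N)` have regular
sequences of the same lengths. -/
theorem ExtVanishes.hasRegularSequence_linearMap_iff (n : ℕ) (h : ExtVanishes R X N)
    [hH : Nontrivial (X →ₗ[R] N)] :
    HasRegularSequence R n (X →ₗ[R] N) ↔ HasRegularSequence R n N := by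
  induction n generalizing N with
  | zero =>
    have : Nontrivial N := by
      by_contra! hN
      exact not_subsingleton (X →ₗ[R] N) inferInstance
    exact iff_of_true hasRegularSequence_zero hasRegularSequence_zero
  | succ n ih =>
    have key {x : R} (hxm : x ∈ maximalIdeal R) (hx : IsSMulRegular N x) :
        HasRegularSequence R n (QuotSMulTop x (X →ₗ[R] N)) ↔
          HasRegularSequence R n (QuotSMulTop x N) := by
      obtain ⟨e⟩ := h.nonempty_quotSMulTop_linearMap_equiv hx
      have := nontrivial_quotSMulTop_of_mem_maximalIdeal (X →ₗ[R] N) hxm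
      have : Nontrivial (X →ₗ[R] QuotSMulTop x N) := e.symm.nontrivial
      rw [HasRegularSequence.congr e, ih (h.quotSMulTop hx)]
    constructor
    · intro hreg
      obtain ⟨x, hxm, hx, -⟩ := (hasRegularSequence_succ_iff n).mp hreg
      have : Nontrivial X := by
        by_contra! hX
        exact not_subsingleton (X →ₗ[R] N) inferInstance
      obtain ⟨y, hym, hy⟩ := exists_isSMulRegular_of_isSMulRegular_linearMap hxm hx
      exact (hasRegularSequence_succ_iff n).mpr
        ⟨y, hym, hy, (key hym hy).mp (hreg.quotSMulTop hym (hy.linearMap X))⟩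
    · intro hreg
      obtain ⟨x, hxm, hx, hq⟩ := (hasRegularSequence_succ_iff n).mp hreg
      exact (hasRegularSequence_succ_iff n).mpr ⟨x, hxm, hx.linearMap X, (key hxm hx).mpr hq⟩

end RegularSequences

section Evaluation

variable {R : Type u} [CommRing R]

open TensorProduct

/-- The natural map `M ⊗ N → Hom(M^*, N)`, `m ⊗ n ↦ (φ ↦ φ m • n)`. -/
noncomputable def tensorToHomDual (M N : Type u) [AddCommGroup M] [Module R M] [AddCommGroup N]
    [Module R N] : M ⊗[R] N →ₗ[R] (Module.Dual R M →ₗ[R] N) :=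
  dualTensorHom R (Module.Dual R M) N ∘ₗ (Module.Dual.eval R M).rTensor N

variable {M P Q N : Type u} [AddCommGroup M] [Module R M] [AddCommGroup N] [Module R N]
  [AddCommGroup P] [Module R P] [AddCommGroup Q] [Module R Q]

lemma tensorToHomDual_tmul (m : M) (n : N) (φ : Module.Dual R M) :
    tensorToHomDual M N (m ⊗ₜ[R] n) φ = φ m • n := by
  simp [tensorToHomDual]

lemma tensorToHomDual_naturality (f : P →ₗ[R] M) (t : P ⊗[R] N) :
    tensorToHomDual M N (f.rTensor N t) = tensorToHomDual P N t ∘ₗ f.dualMap := by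
  induction t with
  | zero => simp
  | add a b ha hb => simp [ha, hb, LinearMap.add_comp]
  | tmul p n => ext φ; simp [tensorToHomDual_tmul]

lemma tensorToHomDual_bijective [Module.Free R P] [Module.Finite R P] :
    Function.Bijective (tensorToHomDual (R := R) P N) := by
  have h : tensorToHomDual (R := R) P N = ((Module.evalEquiv R P).rTensor N ≪≫ₗ
      dualTensorHomEquiv R (Module.Dual R P) N).toLinearMap := by
    ext; simp [tensorToHomDual]
  rw [h]
  exact LinearEquiv.bijective _

/-- If `Q → P → M → 0` is a finite free presentation with transpose `T`, and `Ext^i(T, N) = 0` for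
`i ≥ 1`, then `M ⊗ N → Hom(M^*, N)` is bijective and `Ext^i(M^*, N) = 0` for `i ≥ 1`. -/
theorem ExtVanishes.tensorToHomDual_bijective_and_dual [Module.Free R P] [Module.Finite R P]
    [Module.Free R Q] [Module.Finite R Q] {f : Q →ₗ[R] P} {ε : P →ₗ[R] M}
    (hε : Function.Surjective ε) (hfε : Function.Exact f ε)
    (h : ExtVanishes R (Module.Dual R Q ⧸ LinearMap.range f.dualMap) N) :
    Function.Bijective (tensorToHomDual (R := R) M N) ∧ ExtVanishes R (Module.Dual R M) N := by
  let I := LinearMap.range f.dualMap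
  have hI : ExtVanishes R I N := h.of_shortExact_of_projective
    I.injective_subtype I.mkQ_surjective (LinearMap.exact_subtype_mkQ I)
  have hinj : Function.Injective ε.dualMap := LinearMap.dualMap_injective_of_surjective hε
  have hex : Function.Exact ε.dualMap f.dualMap := by
    rw [LinearMap.exact_iff, LinearMap.ker_dualMap_eq_dualAnnihilator_range, ← hfε.linearMap_ker_eq,
      LinearMap.range_dualMap_eq_dualAnnihilator_ker_of_surjective ε hε]
  have hex' : Function.Exact ε.dualMap f.dualMap.rangeRestrict := fun φ ↦ by
    rw [← hex φ, ← Subtype.coe_inj]; rfl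
  refine ⟨⟨?_, fun g ↦ ?_⟩,
    hI.of_shortExact_of_projective hinj f.dualMap.surjective_rangeRestrict hex'⟩
  · rw [injective_iff_map_eq_zero]
    intro t ht
    obtain ⟨s, rfl⟩ := LinearMap.rTensor_surjective N hε t
    rw [tensorToHomDual_naturality] at ht
    obtain ⟨l, hl⟩ := h.exists_comp_eq (g := f.dualMap) (φ := tensorToHomDual P N s) fun φ hφ ↦ by
      obtain ⟨ψ, rfl⟩ := (hex φ).mp hφ
      exact LinearMap.congr_fun ht ψ
    obtain ⟨r, rfl⟩ := tensorToHomDual_bijective.2 l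
    have hs : s = f.rTensor N r := by
      apply tensorToHomDual_bijective.1
      rw [tensorToHomDual_naturality, hl]
    rw [hs]
    exact (rTensor_exact N hfε hε).apply_apply_eq_zero r
  · obtain ⟨g', rfl⟩ := hI.exists_extension hinj f.dualMap.surjective_rangeRestrict hex' g
    obtain ⟨s, rfl⟩ := tensorToHomDual_bijective.2 g'
    exact ⟨ε.rTensor N s, tensorToHomDual_naturality ε s⟩

lemma IsLocalRing.exists_surjective_residueField [IsLocalRing R] (M : Type u) [AddCommGroup M]
    [Module R M] [Module.Finite R M] [Nontrivial M] :
    ∃ φ : M →ₗ[R] ResidueField R, Function.Surjective φ := by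
  obtain ⟨I, φ, hI, hφ⟩ := Module.exists_surjective_quotient_of_finite R M
  exact ⟨Submodule.factor (le_maximalIdeal hI) ∘ₗ φ,
    (Submodule.factor_surjective (le_maximalIdeal hI)).comp hφ⟩

lemma IsLocalRing.nontrivial_tensorProduct [IsLocalRing R] (M N : Type u) [AddCommGroup M]
    [Module R M] [Module.Finite R M] [Nontrivial M] [AddCommGroup N] [Module R N]
    [Module.Finite R N] [Nontrivial N] : Nontrivial (M ⊗[R] N) := by
  obtain ⟨φ, hφ⟩ := exists_surjective_residueField (R := R) M
  obtain ⟨ψ, hψ⟩ := exists_surjective_residueField (R := R) N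
  have hsurj : Function.Surjective
      (LinearMap.mul' R (ResidueField R) ∘ₗ TensorProduct.map φ ψ) := fun x ↦ by
    obtain ⟨m, rfl⟩ := hφ x
    obtain ⟨n, hn⟩ := hψ 1
    exact ⟨m ⊗ₜ n, by simp [hn]⟩
  exact hsurj.nontrivial

end Evaluation

/-- If `M`, `N` are nonzero finitely generated modules over a commutative Noetherian
local ring `R` and `Ext^i_R(Tr M, N) = 0` for all `i ≥ 1`, then
`M ⊗_R N ≅ Hom_R(M^*, N)` and `depth (M ⊗_R N) = depth N`. -/
theorem tensor_iso_homDual_and_depth_eq_of_ext_trM_vanishing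
    (R : Type) [CommRing R] [IsNoetherianRing R] [IsLocalRing R]
    (M N : Type) [AddCommGroup M] [Module R M] [AddCommGroup N] [Module R N]
    [Module.Finite R M] [Module.Finite R N] [Nontrivial M] [Nontrivial N]
    (pr : FiniteFreePresentation R M)
    (hext : ∀ i : ℕ, 1 ≤ i → Subsingleton (extMod R i pr.tr N)) :
    Nonempty (TensorProduct R M N ≃ₗ[R] (Module.Dual R M →ₗ[R] N)) ∧
    moduleDepth R (TensorProduct R M N) = moduleDepth R N := by
  have := pr.free0
  have := pr.free1
  have := pr.finite0
  have := pr.finite1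
  have hT : ExtVanishes R pr.tr N := fun i ↦
    subsingleton_abelianExt_of_subsingleton_ext _ _ i (hext (i + 1) (by lia))
  obtain ⟨hbij, hdual⟩ := hT.tensorToHomDual_bijective_and_dual pr.surj pr.exact_at
  let e := LinearEquiv.ofBijective _ hbij
  refine ⟨⟨e⟩, ?_⟩
  have : Nontrivial (TensorProduct R M N) := nontrivial_tensorProduct M N
  have : Nontrivial (Module.Dual R M →ₗ[R] N) := e.symm.nontrivial
  refine congrArg sSup (Set.ext fun n ↦ ?_)
  exact (HasRegularSequence.congr e n).trans (hdual.hasRegularSequence_linearMap_iff n)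
end
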